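/- Let F̂ be a Darboux transform with parameter μ of a discrete isothermic net F with cross ratio factorizing function a, with ⟨F_i,F̂_i⟩ ≠ 0 at every vertex and with F̂ regular (on every face the four values of F̂ pairwise non-proportional). Then: (i) for every edge (ij) and every λ ∈ ℝ with λ·a_{ij} ≠ 1 and λ ≠ μ, one has the identity of linear maps Γ^{1−λ/μ}_{F_i,F̂_i} ∘ Γ^{1−λ·a_{ij}}_{F̂_i,F̂_j} = Γ^{1−λ·a_{ij}}_{F_i,F_j} ∘ Γ^{1−λ/μ}_{F_j,F̂_j}; and (ii) consequently F̂ is discrete isothermic with the same cross ratio factorizing function a, and if T^λ is a Calapso transformation of F then T̂^λ_i := T^λ_i ∘ Γ^{1−λ/μ}_{F_i,F̂_i} defines a Calapso transformation of F̂ at parameter λ. -/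

import Mathlib

noncomputable section

/-- The Minkowski bilinear form of signature (4,1) on `ℝ^5`. -/
def mink (x y : Fin 5 → ℝ) : ℝ :=
  -(x 0 * y 0) + x 1 * y 1 + x 2 * y 2 + x 3 * y 3 + x 4 * y 4

/-- The light cone `L⁴ ⊂ ℝ^{4,1}`. -/
def LightCone (x : Fin 5 → ℝ) : Prop :=
  x ≠ 0 ∧ mink x x = 0

/-- The map `Γ^q_{p,p'}` of the paper. -/
def Gamma (p p' : Fin 5 → ℝ) (q : ℝ) (X : Fin 5 → ℝ) : Fin 5 → ℝ :=
  X + (1 / mink p p') •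
    (((q - 1) * mink X p') • p + ((1 / q - 1) * mink X p) • p')

/-- Two vectors are proportional if one is a scalar multiple of the other. -/
def Proportional (x y : Fin 5 → ℝ) : Prop :=
  (∃ t : ℝ, y = t • x) ∨ (∃ t : ℝ, x = t • y)

/-- Membership in the rectangular grid `M`. -/
def InGrid (m₁ m₂ n₁ n₂ : ℤ) (i : ℤ × ℤ) : Prop :=
  m₁ ≤ i.1 ∧ i.1 ≤ m₂ ∧ n₁ ≤ i.2 ∧ i.2 ≤ n₂

/-- `(i,j)` is an edge of the grid (in either orientation). -/
def IsEdge (m₁ m₂ n₁ n₂ : ℤ) (i j : ℤ × ℤ) : Prop :=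
  InGrid m₁ m₂ n₁ n₂ i ∧ InGrid m₁ m₂ n₁ n₂ j ∧
    ((j.1 = i.1 + 1 ∧ j.2 = i.2) ∨ (i.1 = j.1 + 1 ∧ i.2 = j.2) ∨
     (j.1 = i.1 ∧ j.2 = i.2 + 1) ∨ (i.1 = j.1 ∧ i.2 = j.2 + 1))

/-- `(i,j,k,l)` is an elementary quadrilateral (face) of the grid. -/
def IsFace (m₁ m₂ n₁ n₂ : ℤ) (i j k l : ℤ × ℤ) : Prop :=
  InGrid m₁ m₂ n₁ n₂ i ∧ InGrid m₁ m₂ n₁ n₂ k ∧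
    j = (i.1 + 1, i.2) ∧ k = (i.1 + 1, i.2 + 1) ∧ l = (i.1, i.2 + 1)

/-- Four vectors are pairwise non-proportional. -/
def FaceRegular (v w x y : Fin 5 → ℝ) : Prop :=
  ¬ Proportional v w ∧ ¬ Proportional v x ∧ ¬ Proportional v y ∧
  ¬ Proportional w x ∧ ¬ Proportional w y ∧ ¬ Proportional x y

/-- A discrete isothermic net (with values in the light cone) with cross ratio
factorizing function `a`. -/
structure IsIsothermic (m₁ m₂ n₁ n₂ : ℤ) (F : ℤ × ℤ → Fin 5 → ℝ)
    (a : ℤ × ℤ → ℤ × ℤ → ℝ) : Prop where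
  lightcone : ∀ i, InGrid m₁ m₂ n₁ n₂ i → LightCone (F i)
  regular : ∀ i j k l, IsFace m₁ m₂ n₁ n₂ i j k l →
    FaceRegular (F i) (F j) (F k) (F l)
  symm : ∀ i j, IsEdge m₁ m₂ n₁ n₂ i j → a i j = a j i
  nonzero : ∀ i j, IsEdge m₁ m₂ n₁ n₂ i j → a i j ≠ 0
  opposite : ∀ i j k l, IsFace m₁ m₂ n₁ n₂ i j k l →
    a i j = a l k ∧ a i l = a j k
  cross : ∀ i j k l, IsFace m₁ m₂ n₁ n₂ i j k l →
    ∃ t : ℝ, t ≠ 0 ∧ F k = t • Gamma (F j) (F l) (a i j / a i l) (F i)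

/-- Evaluation of the polynomial with vector coefficients `P i 0, …, P i N`
at the spectral parameter `lam`. -/
def pcqEval (N : ℕ) (P : ℤ × ℤ → ℕ → Fin 5 → ℝ) (i : ℤ × ℤ) (lam : ℝ) :
    Fin 5 → ℝ :=
  ∑ k ∈ Finset.range (N + 1), lam ^ k • P i k

/-- `P` is a polynomial conserved quantity of degree at most `N` of the net `F`
with cross ratio factorizing function `a`. -/
def IsPCQ (m₁ m₂ n₁ n₂ : ℤ) (F : ℤ × ℤ → Fin 5 → ℝ) (a : ℤ × ℤ → ℤ × ℤ → ℝ)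
    (N : ℕ) (P : ℤ × ℤ → ℕ → Fin 5 → ℝ) : Prop :=
  ∀ i j, IsEdge m₁ m₂ n₁ n₂ i j → ∀ lam : ℝ, lam * a i j ≠ 1 →
    pcqEval N P i lam = Gamma (F i) (F j) (1 - lam * a i j) (pcqEval N P j lam)

/-- A polynomial conserved quantity is normalized (of degree `N`) if its top
coefficient has Minkowski square norm one at every vertex. -/
def Normalized (m₁ m₂ n₁ n₂ : ℤ) (N : ℕ) (P : ℤ × ℤ → ℕ → Fin 5 → ℝ) : Prop :=
  ∀ i, InGrid m₁ m₂ n₁ n₂ i → mink (P i N) (P i N) = 1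

/-- A Darboux transform of `F` with parameter `μ`. -/
def IsDarboux (m₁ m₂ n₁ n₂ : ℤ) (F : ℤ × ℤ → Fin 5 → ℝ) (a : ℤ × ℤ → ℤ × ℤ → ℝ)
    (μ : ℝ) (Fh : ℤ × ℤ → Fin 5 → ℝ) : Prop :=
  (∀ i, InGrid m₁ m₂ n₁ n₂ i → LightCone (Fh i)) ∧
  (∀ i, InGrid m₁ m₂ n₁ n₂ i → ¬ Proportional (F i) (Fh i)) ∧
  (∀ i j, IsEdge m₁ m₂ n₁ n₂ i j → Fh i = Gamma (F i) (F j) (1 - μ * a i j) (Fh j))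

/-- A Calapso transformation of `F` at parameter `μ`: a vertexwise family of
linear isometries of `ℝ^{4,1}` gauging the isothermic connection at `μ` to the
trivial connection. -/
def IsCalapso (m₁ m₂ n₁ n₂ : ℤ) (F : ℤ × ℤ → Fin 5 → ℝ) (a : ℤ × ℤ → ℤ × ℤ → ℝ)
    (μ : ℝ) (T : ℤ × ℤ → (Fin 5 → ℝ) → (Fin 5 → ℝ)) : Prop :=
  (∀ i, InGrid m₁ m₂ n₁ n₂ i → IsLinearMap ℝ (T i)) ∧
  (∀ i, InGrid m₁ m₂ n₁ n₂ i → ∀ x y, mink (T i x) (T i y) = mink x y) ∧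
  (∀ i j, IsEdge m₁ m₂ n₁ n₂ i j → ∀ x,
    T j x = T i (Gamma (F i) (F j) (1 - μ * a i j) x))

theorem mk_comm (x y : Fin 5 → ℝ) : mink x y = mink y x := by
  unfold mink; ring

theorem mk_addl (x y z : Fin 5 → ℝ) : mink (x + y) z = mink x z + mink y z := by
  simp only [mink, Pi.add_apply]; ring

theorem mk_addr (x y z : Fin 5 → ℝ) : mink z (x + y) = mink z x + mink z y := by
  simp only [mink, Pi.add_apply]; ring

theorem mk_smull (c : ℝ) (x z : Fin 5 → ℝ) : mink (c • x) z = c * mink x z := by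
  simp only [mink, Pi.smul_apply, smul_eq_mul]; ring

theorem mk_smulr (c : ℝ) (x z : Fin 5 → ℝ) : mink z (c • x) = c * mink z x := by
  simp only [mink, Pi.smul_apply, smul_eq_mul]; ring

theorem prop_of_mink_zero (x y : Fin 5 → ℝ) (hx : LightCone x) (hy : LightCone y)
    (h : mink x y = 0) : ∃ t : ℝ, y = t • x := by
  obtain ⟨hx0, hxx⟩ := hx
  obtain ⟨-, hyy⟩ := hy
  have h0 : x 0 ≠ 0 := by
    intro h0
    apply hx0
    simp only [mink, h0] at hxx
    ext n
    fin_cases n <;> simp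
    · exact h0
    all_goals nlinarith [sq_nonneg (x 1), sq_nonneg (x 2), sq_nonneg (x 3), sq_nonneg (x 4)]
  simp only [mink] at hxx hyy h
  have key : (x 0 * y 1 - y 0 * x 1)^2 + (x 0 * y 2 - y 0 * x 2)^2
      + (x 0 * y 3 - y 0 * x 3)^2 + (x 0 * y 4 - y 0 * x 4)^2 = 0 := by
    linear_combination (y 0)^2 * hxx + (x 0)^2 * hyy - 2 * x 0 * y 0 * h
  have h1 := sq_nonneg (x 0 * y 1 - y 0 * x 1)
  have h2 := sq_nonneg (x 0 * y 2 - y 0 * x 2)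
  have h3 := sq_nonneg (x 0 * y 3 - y 0 * x 3)
  have h4 := sq_nonneg (x 0 * y 4 - y 0 * x 4)
  have e1 : x 0 * y 1 - y 0 * x 1 = 0 := pow_eq_zero_iff (two_ne_zero) |>.1 (by linarith)
  have e2 : x 0 * y 2 - y 0 * x 2 = 0 := pow_eq_zero_iff (two_ne_zero) |>.1 (by linarith)
  have e3 : x 0 * y 3 - y 0 * x 3 = 0 := pow_eq_zero_iff (two_ne_zero) |>.1 (by linarith)
  have e4 : x 0 * y 4 - y 0 * x 4 = 0 := pow_eq_zero_iff (two_ne_zero) |>.1 (by linarith)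
  refine ⟨y 0 / x 0, ?_⟩
  ext n
  simp only [Pi.smul_apply, smul_eq_mul]
  rw [div_mul_eq_mul_div, eq_div_iff h0]
  fin_cases n <;> simp <;> linarith

theorem mink_ne_zero_of (x y : Fin 5 → ℝ) (hx : LightCone x) (hy : LightCone y)
    (h : ¬ Proportional x y) : mink x y ≠ 0 := fun h0 =>
  h (Or.inl (prop_of_mink_zero x y hx hy h0))

theorem gamma_scale (p p' : Fin 5 → ℝ) (q c : ℝ) (hc : c ≠ 0) (X : Fin 5 → ℝ) :
    Gamma (c • p) p' q X = Gamma p p' q X := by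
  unfold Gamma
  rw [mk_smull, mk_smulr]
  by_cases h : mink p p' = 0
  · simp [h]
  ext n
  simp only [Pi.add_apply, Pi.smul_apply, smul_eq_mul]
  generalize 1 / q = q'
  field_simp

theorem gamma_of_zero (p p' : Fin 5 → ℝ) (q : ℝ) (X : Fin 5 → ℝ) (h : mink p p' = 0) :
    Gamma p p' q X = X := by
  simp [Gamma, h]

theorem gamma_lin (p p' : Fin 5 → ℝ) (q : ℝ) : IsLinearMap ℝ (Gamma p p' q) := by
  constructor
  · intro x y
    ext n
    simp only [Gamma, mk_addl, Pi.add_apply, Pi.smul_apply, smul_eq_mul]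
    ring
  · intro c x
    ext n
    simp only [Gamma, mk_smull, Pi.add_apply, Pi.smul_apply, smul_eq_mul]
    ring

theorem gamma_iso (p p' : Fin 5 → ℝ) (q : ℝ) (hq : q ≠ 0) (hp : mink p p = 0)
    (hp' : mink p' p' = 0) (X Y : Fin 5 → ℝ) :
    mink (Gamma p p' q X) (Gamma p p' q Y) = mink X Y := by
  by_cases h : mink p p' = 0
  · simp [gamma_of_zero, h]
  simp only [Gamma, mk_addl, mk_addr, mk_smull, mk_smulr, hp, hp', mk_comm p' p, mk_comm p Y,
    mk_comm p' Y]
  field_simp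
  ring

theorem gamma_ne_zero (p p' : Fin 5 → ℝ) (q : ℝ) (hq : q ≠ 0) (hp : mink p p = 0)
    (hp' : mink p' p' = 0) (X Y : Fin 5 → ℝ) (h : mink X Y ≠ 0) :
    Gamma p p' q X ≠ 0 := by
  intro h0
  apply h
  rw [← gamma_iso p p' q hq hp hp', h0]
  simp [mink]

/-- edge identity -/
theorem edge_id (Fi Fj hi hj : Fin 5 → ℝ) (μ a lam : ℝ) (hμ : μ ≠ 0) (ha : a ≠ 0)
    (hμa : 1 - μ * a ≠ 0) (hla : 1 - lam * a ≠ 0) (hl : μ - lam ≠ 0)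
    (Li : LightCone Fi) (Lj : LightCone Fj) (Hj : LightCone hj)
    (ni : mink Fi hi ≠ 0) (nj : mink Fj hj ≠ 0)
    (hD : hi = Gamma Fi Fj (1 - μ * a) hj) (X : Fin 5 → ℝ) :
    Gamma Fi hi (1 - lam / μ) (Gamma hi hj (1 - lam * a) X)
      = Gamma Fi Fj (1 - lam * a) (Gamma Fj hj (1 - lam / μ) X) := by
  by_cases hA : mink Fi Fj = 0
  · rw [gamma_of_zero _ _ _ _ hA] at hD
    subst hD
    rw [gamma_of_zero _ _ _ _ hA, gamma_of_zero _ _ _ _ Hj.2]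
    obtain ⟨t, rfl⟩ := prop_of_mink_zero _ _ Li Lj hA
    rw [gamma_scale]
    rintro rfl
    exact Lj.1 (by simp)
  have pi := Li.2
  have pj := Lj.2
  have pk := Hj.2
  have hs : 1 - lam / μ ≠ 0 := by
    intro h
    apply hl
    field_simp at h
    linarith
  obtain ⟨A, eA⟩ : ∃ A, mink Fi Fj = A := ⟨_, rfl⟩
  obtain ⟨u, eu⟩ : ∃ u, mink Fi hj = u := ⟨_, rfl⟩
  obtain ⟨v, ev⟩ : ∃ v, mink Fj hj = v := ⟨_, rfl⟩
  have eA' : mink Fj Fi = A := by rw [mk_comm, eA]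
  have eu' : mink hj Fi = u := by rw [mk_comm, eu]
  have ev' : mink hj Fj = v := by rw [mk_comm, ev]
  obtain ⟨x1, e1⟩ : ∃ x, mink X Fi = x := ⟨_, rfl⟩
  obtain ⟨x2, e2⟩ : ∃ x, mink X Fj = x := ⟨_, rfl⟩
  obtain ⟨x3, e3⟩ : ∃ x, mink X hj = x := ⟨_, rfl⟩
  rw [eA] at hA
  rw [ev] at nj
  obtain ⟨q, hq⟩ : ∃ q, 1 - μ * a = q := ⟨_, rfl⟩
  rw [hq] at hD hμa
  have E1 : mink Fi hi = u / q := by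
    rw [hD]
    simp only [Gamma, mk_addr, mk_smulr, pi, eA, eu, eu', ev']
    field_simp
    ring
  have E2 : mink hi hj = (q - 1)^2 * u * v / (q * A) := by
    rw [hD]
    simp only [Gamma, mk_addl, mk_smull, pk, eA, eu, eu', ev', ev]
    field_simp
    ring
  have E3 : mink X hi = x3 + 1 / A * ((q - 1) * v * x1 + (1 / q - 1) * u * x2) := by
    rw [hD]
    simp only [Gamma, mk_addr, mk_smulr, eA, eu', ev', e1, e2, e3]
  have E1' : mink hi Fi = u / q := by rw [mk_comm, E1]
  have E2' : mink hj hi = (q - 1)^2 * u * v / (q * A) := by rw [mk_comm, E2]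
  have E4 : mink hi hi = 0 := by
    rw [hD, gamma_iso _ _ _ hμa pi pj, pk]
  rw [E1] at ni
  have hu : u ≠ 0 := by
    rintro rfl
    simp at ni
  have hq1 : q - 1 ≠ 0 := by
    rw [← hq]
    simp [hμ, ha]
  have haq : a = (1 - q) / μ := by
    rw [← hq]; field_simp; ring
  have hla' : μ - lam * (1 - q) ≠ 0 := by
    intro h
    apply hla
    rw [haq]
    field_simp
    linarith
  ext n
  have D : hi n = hj n + 1 / A * ((q - 1) * v * Fi n + (1 / q - 1) * u * Fj n) := by
    rw [hD]
    simp only [Gamma, Pi.add_apply, Pi.smul_apply, smul_eq_mul, eA, eu', ev']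
  simp only [Gamma, mk_addl, mk_smull, Pi.add_apply, Pi.smul_apply, smul_eq_mul, E1, E2, E3, E4,
    E1', E2', pi, pj, pk, eA, eA', eu, eu', ev, ev', e1, e2, e3, D]
  rw [haq]
  have r1 : 1 - lam * ((1 - q) / μ) = (μ - lam * (1 - q)) / μ := by field_simp
  have r2 : 1 - lam / μ = (μ - lam) / μ := by field_simp
  rw [r1, r2]
  field_simp
  ring

/-- `Γ_{kj} Γ_{ji} = Γ_{jl}` -/
theorem face_id (Fi Fj Fl Fk : Fin 5 → ℝ) (t μ a b : ℝ) (ht : t ≠ 0)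
    (ha : a ≠ 0) (hb : b ≠ 0)
    (hα : 1 - μ * a ≠ 0) (hβ : 1 - μ * b ≠ 0)
    (pi : mink Fi Fi = 0) (pj : mink Fj Fj = 0)
    (nA : mink Fi Fj ≠ 0) (nC : mink Fj Fl ≠ 0)
    (hk : Fk = t • Gamma Fj Fl (a / b) Fi) (X : Fin 5 → ℝ) :
    Gamma Fk Fj (1 - μ * b) (Gamma Fj Fi (1 - μ * a) X)
      = Gamma Fj Fl ((1 - μ * a) / (1 - μ * b)) X := by
  rw [hk, gamma_scale _ _ _ _ ht]
  obtain ⟨A, eA⟩ : ∃ A, mink Fi Fj = A := ⟨_, rfl⟩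
  obtain ⟨B, eB⟩ : ∃ u, mink Fi Fl = u := ⟨_, rfl⟩
  obtain ⟨C, eC⟩ : ∃ v, mink Fj Fl = v := ⟨_, rfl⟩
  have eA' : mink Fj Fi = A := by rw [mk_comm, eA]
  have eB' : mink Fl Fi = B := by rw [mk_comm, eB]
  have eC' : mink Fl Fj = C := by rw [mk_comm, eC]
  obtain ⟨x1, e1⟩ : ∃ x, mink X Fi = x := ⟨_, rfl⟩
  obtain ⟨x2, e2⟩ : ∃ x, mink X Fj = x := ⟨_, rfl⟩
  obtain ⟨x3, e3⟩ : ∃ x, mink X Fl = x := ⟨_, rfl⟩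
  rw [eA] at nA
  rw [eC] at nC
  have E : mink (Gamma Fj Fl (a / b) Fi) Fj = A * b / a := by
    simp only [Gamma, mk_addl, mk_smull, pj, eA, eA', eB, eB', eC, eC']
    field_simp
    ring
  ext n
  rw [Gamma, E]
  simp only [Gamma, mk_addl, mk_addr, mk_smull, mk_smulr, Pi.add_apply, Pi.smul_apply,
    smul_eq_mul, pi, pj, eA, eA', eB, eB', eC, eC', e1, e2, e3]
  field_simp
  ring

/-- tetrahedral formula versus cross ratio of the transform -/
theorem face_hat (Fi Fj Fl h hj hl : Fin 5 → ℝ) (μ a b : ℝ) (hμ : μ ≠ 0)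
    (ha : a ≠ 0) (hb : b ≠ 0)
    (hα : 1 - μ * a ≠ 0) (hβ : 1 - μ * b ≠ 0)
    (pi : mink Fi Fi = 0) (ph : mink h h = 0)
    (nA : mink Fi Fj ≠ 0) (nB : mink Fi Fl ≠ 0) (nC : mink Fj Fl ≠ 0)
    (nD : mink hj hl ≠ 0)
    (ej : hj = Gamma Fj Fi (1 - μ * a) h) (el : hl = Gamma Fl Fi (1 - μ * b) h) :
    ∃ s : ℝ, Gamma hj hl (a / b) h = s • Gamma Fj Fl ((1 - μ * a) / (1 - μ * b)) h := by
  obtain ⟨A, eA⟩ : ∃ A, mink Fi Fj = A := ⟨_, rfl⟩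
  obtain ⟨B, eB⟩ : ∃ u, mink Fi Fl = u := ⟨_, rfl⟩
  obtain ⟨C, eC⟩ : ∃ v, mink Fj Fl = v := ⟨_, rfl⟩
  have eA' : mink Fj Fi = A := by rw [mk_comm, eA]
  have eB' : mink Fl Fi = B := by rw [mk_comm, eB]
  have eC' : mink Fl Fj = C := by rw [mk_comm, eC]
  obtain ⟨u, e1⟩ : ∃ x, mink h Fi = x := ⟨_, rfl⟩
  obtain ⟨v, e2⟩ : ∃ x, mink h Fj = x := ⟨_, rfl⟩
  obtain ⟨w, e3⟩ : ∃ x, mink h Fl = x := ⟨_, rfl⟩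
  have e1' : mink Fi h = u := by rw [mk_comm, e1]
  have e2' : mink Fj h = v := by rw [mk_comm, e2]
  have e3' : mink Fl h = w := by rw [mk_comm, e3]
  rw [eA] at nA
  rw [eB] at nB
  rw [eC] at nC
  have Pj : mink h hj = (μ * a)^2 * u * v / ((1 - μ * a) * A) := by
    rw [ej]
    simp only [Gamma, mk_addr, mk_smulr, ph, eA', e1, e2]
    field_simp
    ring
  have Pl : mink h hl = (μ * b)^2 * u * w / ((1 - μ * b) * B) := by
    rw [el]
    simp only [Gamma, mk_addr, mk_smulr, ph, eB', e1, e3]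
    field_simp
    ring
  obtain ⟨D, eD⟩ : ∃ D, mink hj hl = D := ⟨_, rfl⟩
  have eD2 := eD
  rw [ej, el] at eD2
  simp only [Gamma, mk_addl, mk_addr, mk_smull, mk_smulr, pi, ph, eA, eA', eB, eB', eC, eC', e1,
    e1', e2, e2', e3, e3'] at eD2
  rw [eD] at nD
  refine ⟨1 + (1 / D) * ((a / b - 1) * ((μ * b)^2 * u * w / ((1 - μ * b) * B))
    + (1 / (a / b) - 1) * ((μ * a)^2 * u * v / ((1 - μ * a) * A))), ?_⟩
  ext n
  rw [Gamma, eD, Pj, Pl, ej, el]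
  simp only [Gamma, Pi.add_apply, Pi.smul_apply,
    smul_eq_mul, eA, eA', eB, eB', eC, eC', e1, e2, e3]
  have comb : ∀ hn Y W S : ℝ, Y = D * W + S * (hn + W) →
      hn + 1 / D * Y = (1 + 1 / D * S) * (hn + W) := by
    intro hn Y W S h
    rw [h]
    field_simp
    ring
  apply comb
  rw [← eD2]
  clear comb eD2 Pj Pl ej el
  obtain ⟨α, eα⟩ : ∃ α, 1 - μ * a = α := ⟨_, rfl⟩
  obtain ⟨β, eβ⟩ : ∃ β, 1 - μ * b = β := ⟨_, rfl⟩
  have hμa : μ * a = 1 - α := by linarith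
  have hμb : μ * b = 1 - β := by linarith
  have hab : a / b = (1 - α) / (1 - β) := by
    rw [← hμa, ← hμb]
    field_simp
  have n1 : 1 - α ≠ 0 := by rw [← hμa]; exact mul_ne_zero hμ ha
  have n2 : 1 - β ≠ 0 := by rw [← hμb]; exact mul_ne_zero hμ hb
  rw [eα] at hα
  rw [eβ] at hβ
  rw [hab, eα, eβ, hμa, hμb]
  field_simp
  ring

/-- a Darboux transform of a discrete isothermic net is again
isothermic with the same cross ratio factorizing function, the corresponding
connections are intertwined by the maps `Γ^{1-λ/μ}_{F,F̂}`, and the Calapso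
transformations of the Darboux transform are obtained by gauging. -/
theorem statement12 (m₁ m₂ n₁ n₂ : ℤ) (F Fh : ℤ × ℤ → Fin 5 → ℝ)
    (a : ℤ × ℤ → ℤ × ℤ → ℝ) (μ : ℝ) (hμ0 : μ ≠ 0)
    (hadm : ∀ i j, IsEdge m₁ m₂ n₁ n₂ i j → μ * a i j ≠ 1)
    (hiso : IsIsothermic m₁ m₂ n₁ n₂ F a)
    (hD : IsDarboux m₁ m₂ n₁ n₂ F a μ Fh)
    (hprod : ∀ i, InGrid m₁ m₂ n₁ n₂ i → mink (F i) (Fh i) ≠ 0)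
    (hreg : ∀ i j k l, IsFace m₁ m₂ n₁ n₂ i j k l →
      FaceRegular (Fh i) (Fh j) (Fh k) (Fh l)) :
    (∀ i j, IsEdge m₁ m₂ n₁ n₂ i j → ∀ lam : ℝ,
      lam * a i j ≠ 1 → lam ≠ μ → ∀ X : Fin 5 → ℝ,
        Gamma (F i) (Fh i) (1 - lam / μ)
            (Gamma (Fh i) (Fh j) (1 - lam * a i j) X)
          = Gamma (F i) (F j) (1 - lam * a i j)
              (Gamma (F j) (Fh j) (1 - lam / μ) X)) ∧
    IsIsothermic m₁ m₂ n₁ n₂ Fh a ∧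
    (∀ lam : ℝ, (∀ i j, IsEdge m₁ m₂ n₁ n₂ i j → lam * a i j ≠ 1) → lam ≠ μ →
      ∀ T : ℤ × ℤ → (Fin 5 → ℝ) → (Fin 5 → ℝ),
        IsCalapso m₁ m₂ n₁ n₂ F a lam T →
        IsCalapso m₁ m₂ n₁ n₂ Fh a lam
          (fun i x => T i (Gamma (F i) (Fh i) (1 - lam / μ) x))) := by
  obtain ⟨hL, -, hE⟩ := hD
  have part1 : ∀ i j, IsEdge m₁ m₂ n₁ n₂ i j → ∀ lam : ℝ,
      lam * a i j ≠ 1 → lam ≠ μ → ∀ X : Fin 5 → ℝ,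
        Gamma (F i) (Fh i) (1 - lam / μ)
            (Gamma (Fh i) (Fh j) (1 - lam * a i j) X)
          = Gamma (F i) (F j) (1 - lam * a i j)
              (Gamma (F j) (Fh j) (1 - lam / μ) X) := by
    intro i j e lam h1 h2 X
    have gi := e.1
    have gj := e.2.1
    exact edge_id _ _ _ _ μ (a i j) lam hμ0 (hiso.nonzero i j e)
      (sub_ne_zero.2 (hadm i j e).symm) (sub_ne_zero.2 h1.symm) (sub_ne_zero.2 h2.symm)
      (hiso.lightcone i gi) (hiso.lightcone j gj) (hL j gj) (hprod i gi) (hprod j gj)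
      (hE i j e) X
  refine ⟨part1, ⟨hL, hreg, hiso.symm, hiso.nonzero, hiso.opposite, ?_⟩, ?_⟩
  · intro i j k l f
    obtain ⟨ob1, ob2⟩ := hiso.opposite i j k l f
    obtain ⟨r1, r2, r3, r4, r5, r6⟩ := hiso.regular i j k l f
    obtain ⟨s1, s2, s3, s4, s5, s6⟩ := hreg i j k l f
    obtain ⟨t, ht, hk⟩ := hiso.cross i j k l f
    have gi : InGrid m₁ m₂ n₁ n₂ i := f.1
    have gk : InGrid m₁ m₂ n₁ n₂ k := f.2.1
    have f' := f
    obtain ⟨-, -, qj, qk, ql⟩ := f'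
    have gj : InGrid m₁ m₂ n₁ n₂ j := by
      subst qj qk ql; simp only [InGrid] at *; omega
    have gl : InGrid m₁ m₂ n₁ n₂ l := by
      subst qj qk ql; simp only [InGrid] at *; omega
    have eij : IsEdge m₁ m₂ n₁ n₂ i j := ⟨gi, gj, by subst qj; simp⟩
    have eji : IsEdge m₁ m₂ n₁ n₂ j i := ⟨gj, gi, by subst qj; simp⟩
    have eil : IsEdge m₁ m₂ n₁ n₂ i l := ⟨gi, gl, by subst ql; simp⟩
    have eli : IsEdge m₁ m₂ n₁ n₂ l i := ⟨gl, gi, by subst ql; simp⟩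
    have ejk : IsEdge m₁ m₂ n₁ n₂ j k := ⟨gj, gk, by subst qj qk; simp⟩
    have ekj : IsEdge m₁ m₂ n₁ n₂ k j := ⟨gk, gj, by subst qj qk; simp⟩
    have Li := hiso.lightcone i gi
    have Lj := hiso.lightcone j gj
    have Ll := hiso.lightcone l gl
    have ha := hiso.nonzero i j eij
    have hb := hiso.nonzero i l eil
    have hα := sub_ne_zero.2 (hadm i j eij).symm
    have hβ := sub_ne_zero.2 (hadm i l eil).symm
    have nA := mink_ne_zero_of _ _ Li Lj r1
    have nB := mink_ne_zero_of _ _ Li Ll r3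
    have nC := mink_ne_zero_of _ _ Lj Ll r5
    have nD := mink_ne_zero_of _ _ (hL j gj) (hL l gl) s5
    have hj := hE j i eji
    rw [← hiso.symm i j eij] at hj
    have hl := hE l i eli
    rw [← hiso.symm i l eil] at hl
    have hkk := hE k j ekj
    rw [← hiso.symm j k ejk, ← ob2] at hkk
    have hk2 : Fh k = Gamma (F j) (F l) ((1 - μ * a i j) / (1 - μ * a i l)) (Fh i) := by
      rw [hkk, hj]
      exact face_id _ _ _ _ t μ _ _ ht ha hb hα hβ Li.2 Lj.2 nA nC hk _
    obtain ⟨s, hs⟩ := face_hat _ _ _ _ _ _ μ _ _ hμ0 ha hb hα hβ Li.2 (hL i gi).2 nA nB nC nD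
      hj hl
    rw [← hk2] at hs
    have hs0 : s ≠ 0 := by
      rintro rfl
      rw [zero_smul] at hs
      refine gamma_ne_zero _ _ _ (div_ne_zero ha hb) (hL j gj).2 (hL l gl).2 (Fh i) (F i) ?_ hs
      rw [mk_comm]
      exact hprod i gi
    refine ⟨s⁻¹, inv_ne_zero hs0, ?_⟩
    rw [hs, smul_smul, inv_mul_cancel₀ hs0, one_smul]
  · rintro lam hlam hne T ⟨T1, T2, T3⟩
    have hq : 1 - lam / μ ≠ 0 := by
      intro h
      apply hne
      field_simp at h
      linarith
    refine ⟨?_, ?_, ?_⟩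
    · intro i gi
      exact ((T1 i gi).mk'.comp (gamma_lin (F i) (Fh i) (1 - lam / μ)).mk').isLinear
    · intro i gi x y
      show mink (T i _) (T i _) = _
      rw [T2 i gi, gamma_iso _ _ _ hq (hiso.lightcone i gi).2 (hL i gi).2]
    · intro i j e x
      show T j _ = T i _
      rw [T3 i j e, part1 i j e lam (hlam i j e) hne]
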